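/- arXiv:nlin/0312042 — 2 statements merged into one kernel-verified Lean document; each statement's English description precedes it below -/
import Mathlib

section
/- Assume n does not divide m and fix Γ̃ > 0. Given any λ₀ > 0 and ε > 0, there exists K₀ > 0 such that for all K ≥ K₀ and all Γ ≥ Γ̃, every solution u of equation (wff) with parameter λ = λ₀ (and these values of K and Γ) satisfies |(1/(2π)) ∫₀^{2π} sin(s + u(s)) ds| < ε. -/
open Real in
/-- `u` is a solution of equation (wff) with parameter `λ = lam`: a `C²`,
`2π`-periodic function with zero mean on `[0, 2π]` satisfying
`u'' + λΓu' + λ²sin(z+u) = λ²·(1/2π)∫₀^{2π} sin(s+u(s)) ds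
 + λ²K[u(z+2πm/n) − 2u(z) + u(z−2πm/n)]`. -/
def WffSolution (n m : ℕ) (Γ K lam : ℝ) (u : ℝ → ℝ) : Prop :=
  ContDiff ℝ 2 u ∧
  (∀ z : ℝ, u (z + 2 * π) = u z) ∧
  (∫ s in (0:ℝ)..(2 * π), u s) = 0 ∧
  (∀ z : ℝ, deriv (deriv u) z + lam * Γ * deriv u z + lam ^ 2 * Real.sin (z + u z)
      = lam ^ 2 * (1 / (2 * π)) * (∫ s in (0:ℝ)..(2 * π), Real.sin (s + u s))
        + lam ^ 2 * K * (u (z + 2 * π * m / n) - 2 * u z + u (z - 2 * π * m / n)))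

open Real in
/-- The integral of a `T`-periodic function over `[0, T]` is invariant under translation. -/
theorem integral_comp_add_right_of_periodic {f : ℝ → ℝ} {T : ℝ} (hf : Function.Periodic f T)
    (a : ℝ) : ∫ s in (0:ℝ)..T, f (s + a) = ∫ s in (0:ℝ)..T, f s := by
  rw [intervalIntegral.integral_comp_add_right]
  simpa only [zero_add, add_comm a T] using hf.intervalIntegral_add_eq a 0

/-- A `C¹` function with zero mean on `[0, T]` is bounded there by the `L¹` norm of its
derivative. -/
theorem abs_le_integral_abs_deriv_of_integral_eq_zero {u : ℝ → ℝ} {T : ℝ} (hT : 0 < T)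
    (hu : ContDiff ℝ 1 u) (hmean : ∫ s in (0:ℝ)..T, u s = 0) {x : ℝ} (hx : x ∈ Set.Icc 0 T) :
    |u x| ≤ ∫ s in (0:ℝ)..T, |deriv u s| := by
  have huc : Continuous u := hu.continuous
  have hdc : Continuous (deriv u) := hu.continuous_deriv le_rfl
  have hprim (y : ℝ) : HasDerivAt (fun y => ∫ s in (0:ℝ)..y, u s) (u y) y :=
    intervalIntegral.integral_hasDerivAt_right (huc.intervalIntegrable _ _)
      (huc.stronglyMeasurableAtFilter _ _) huc.continuousAt
  obtain ⟨c, hc, hc0⟩ := exists_hasDerivAt_eq_zero hT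
    (fun y _ => (hprim y).continuousAt.continuousWithinAt) (by simp [hmean])
    (fun y _ => hprim y)
  have hftc : ∫ s in c..x, deriv u s = u x := by
    rw [intervalIntegral.integral_deriv_eq_sub
      (fun y _ => (hu.differentiable one_ne_zero).differentiableAt)
      (hdc.intervalIntegrable _ _), hc0, sub_zero]
  have hle : |u x| ≤ |(∫ s in c..x, |deriv u s|)| := by
    rw [← hftc]
    exact intervalIntegral.norm_integral_le_abs_integral_norm (f := deriv u)
  refine hle.trans ?_
  rw [← abs_of_nonneg (intervalIntegral.integral_nonneg hT.le (fun s _ => abs_nonneg (deriv u s)))]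
  refine intervalIntegral.abs_integral_mono_interval ?_ ?_ (hdc.abs.intervalIntegrable _ _)
  · rw [Set.uIoc_of_le hT.le]
    exact Set.Ioc_subset_Ioc (le_min hc.1.le hx.1) (max_le hc.2.le hx.2)
  · exact Filter.Eventually.of_forall fun s => abs_nonneg _

/-- Young's inequality, integrated over an interval. -/
theorem integral_abs_le_add_integral_sq {f : ℝ → ℝ} (hf : Continuous f) {T c : ℝ} (hT : 0 ≤ T)
    (hc : 0 < c) :
    ∫ s in (0:ℝ)..T, |f s| ≤ T * c + (∫ s in (0:ℝ)..T, f s ^ 2) / (4 * c) := by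
  have hsq : IntervalIntegrable (fun s => f s ^ 2 / (4 * c)) MeasureTheory.volume 0 T :=
    ((hf.pow 2).div_const _).intervalIntegrable _ _
  have hmono : ∫ s in (0:ℝ)..T, |f s| ≤ ∫ s in (0:ℝ)..T, (c + f s ^ 2 / (4 * c)) := by
    refine intervalIntegral.integral_mono_on hT (hf.abs.intervalIntegrable _ _)
      ((intervalIntegrable_const (c := c)).add hsq) fun s _ => ?_
    rw [← sub_nonneg]
    have : c + f s ^ 2 / (4 * c) - |f s| = (|f s| - 2 * c) ^ 2 / (4 * c) := by
      rw [← sq_abs (f s)]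
      field_simp
      ring
    rw [this]
    positivity
  rwa [intervalIntegral.integral_add (intervalIntegrable_const (c := c)) hsq,
    intervalIntegral.integral_const, intervalIntegral.integral_div, sub_zero, smul_eq_mul] at hmono

open Real in
/-- The mean of `sin (s + u s)` is controlled by the translation increment `u (s + a) - u s`. -/
theorem two_mul_abs_sin_mul_abs_integral_sin_le {u : ℝ → ℝ} (hu : Continuous u)
    (hper : Function.Periodic u (2 * π)) (a : ℝ) :
    2 * |sin (a / 2)| * |∫ s in (0:ℝ)..(2 * π), sin (s + u s)|
      ≤ ∫ s in (0:ℝ)..(2 * π), |u (s + a) - u s| := by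
  have hT : (0:ℝ) ≤ 2 * π := by positivity
  have hshift : ∫ s in (0:ℝ)..(2 * π), cos (s + a + u (s + a) - a / 2)
      = ∫ s in (0:ℝ)..(2 * π), cos (s + u s - a / 2) := by
    refine integral_comp_add_right_of_periodic (f := fun s => cos (s + u s - a / 2)) ?_ a
    intro s
    simp only [hper s]
    rw [← cos_add_two_pi (s + u s - a / 2)]
    ring_nf
  have hkey : 2 * sin (a / 2) * ∫ s in (0:ℝ)..(2 * π), sin (s + u s)
      = ∫ s in (0:ℝ)..(2 * π), (cos (s + a + u (s + a) - a / 2) - cos (s + u s + a / 2)) := by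
    rw [intervalIntegral.integral_sub (Continuous.intervalIntegrable (by fun_prop) _ _)
      (Continuous.intervalIntegrable (by fun_prop) _ _), hshift,
      ← intervalIntegral.integral_sub (Continuous.intervalIntegrable (by fun_prop) _ _)
      (Continuous.intervalIntegrable (by fun_prop) _ _), ← intervalIntegral.integral_const_mul]
    refine intervalIntegral.integral_congr fun s _ => ?_
    simp only [cos_add, cos_sub]
    ring
  calc 2 * |sin (a / 2)| * |∫ s in (0:ℝ)..(2 * π), sin (s + u s)|
      = |2 * sin (a / 2) * ∫ s in (0:ℝ)..(2 * π), sin (s + u s)| := by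
        rw [abs_mul, abs_mul, abs_two]
    _ ≤ ∫ s in (0:ℝ)..(2 * π), |cos (s + a + u (s + a) - a / 2) - cos (s + u s + a / 2)| := by
        rw [hkey]
        exact intervalIntegral.abs_integral_le_integral_abs hT
    _ ≤ ∫ s in (0:ℝ)..(2 * π), |u (s + a) - u s| := by
        refine intervalIntegral.integral_mono_on hT
          (Continuous.intervalIntegrable (by fun_prop) _ _)
          (Continuous.intervalIntegrable (by fun_prop) _ _) fun s _ => ?_
        refine (abs_cos_sub_cos_le _ _).trans_eq ?_
        ring_nf

/-- Summation by parts for the discrete Laplacian on periodic functions. -/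
theorem integral_discrete_laplacian_mul_self {u : ℝ → ℝ} {T : ℝ} (hu : Continuous u)
    (hper : Function.Periodic u T) (a : ℝ) :
    ∫ s in (0:ℝ)..T, (u (s + a) - 2 * u s + u (s - a)) * u s
      = -∫ s in (0:ℝ)..T, (u (s + a) - u s) ^ 2 := by
  have hperT (s b : ℝ) : u (s + T + b) = u (s + b) := by
    rw [add_right_comm, hper]
  have hsq : ∫ s in (0:ℝ)..T, u (s + a) ^ 2 = ∫ s in (0:ℝ)..T, u s ^ 2 :=
    integral_comp_add_right_of_periodic (f := fun s => u s ^ 2)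
      (fun s => by simp only [hper s]) a
  have hcross : ∫ s in (0:ℝ)..T, u (s - a) * u s = ∫ s in (0:ℝ)..T, u (s + a) * u s := by
    rw [← integral_comp_add_right_of_periodic (f := fun s => u (s - a) * u s) _ a]
    · refine intervalIntegral.integral_congr fun s _ => ?_
      simp only [add_sub_cancel_right]
      ring
    · intro s
      simp only [sub_eq_add_neg, hperT, hper s]
  have hi {f : ℝ → ℝ} (hf : Continuous f) : IntervalIntegrable f MeasureTheory.volume 0 T :=
    hf.intervalIntegrable _ _
  have hl : ∫ s in (0:ℝ)..T, (u (s + a) - 2 * u s + u (s - a)) * u s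
      = (∫ s in (0:ℝ)..T, u (s + a) * u s) - 2 * (∫ s in (0:ℝ)..T, u s ^ 2)
        + ∫ s in (0:ℝ)..T, u (s - a) * u s := by
    rw [← intervalIntegral.integral_const_mul,
      ← intervalIntegral.integral_sub (hi (by fun_prop)) (hi (by fun_prop)),
      ← intervalIntegral.integral_add (hi (by fun_prop)) (hi (by fun_prop))]
    refine intervalIntegral.integral_congr fun s _ => ?_
    ring
  have hr : ∫ s in (0:ℝ)..T, (u (s + a) - u s) ^ 2
      = (∫ s in (0:ℝ)..T, u (s + a) ^ 2) - 2 * (∫ s in (0:ℝ)..T, u (s + a) * u s)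
        + ∫ s in (0:ℝ)..T, u s ^ 2 := by
    rw [← intervalIntegral.integral_const_mul,
      ← intervalIntegral.integral_sub (hi (by fun_prop)) (hi (by fun_prop)),
      ← intervalIntegral.integral_add (hi (by fun_prop)) (hi (by fun_prop))]
    refine intervalIntegral.integral_congr fun s _ => ?_
    ring
  rw [hl, hr, hsq, hcross]
  ring

/-- The derivative of a periodic function is periodic. -/
theorem Function.Periodic.deriv_periodic {u : ℝ → ℝ} {T : ℝ} (hper : Function.Periodic u T) :
    Function.Periodic (deriv u) T := fun s => by
  rw [← deriv_comp_add_const]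
  simp only [hper _]

/-- The discrete Laplacian is symmetric, hence orthogonal to the derivative of a periodic
function. -/
theorem integral_discrete_laplacian_mul_deriv {u : ℝ → ℝ} {T : ℝ} (hu : ContDiff ℝ 1 u)
    (hper : Function.Periodic u T) (a : ℝ) :
    ∫ s in (0:ℝ)..T, (u (s + a) - 2 * u s + u (s - a)) * deriv u s = 0 := by
  have huc : Continuous u := hu.continuous
  have hdc : Continuous (deriv u) := hu.continuous_deriv le_rfl
  have hd (x : ℝ) : HasDerivAt u (deriv u x) x :=
    (hu.differentiable one_ne_zero x).hasDerivAt
  have hi {f : ℝ → ℝ} (hf : Continuous f) : IntervalIntegrable f MeasureTheory.volume 0 T :=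
    hf.intervalIntegrable _ _
  have hdper := hper.deriv_periodic
  have hback : ∫ s in (0:ℝ)..T, u (s - a) * deriv u s
      = ∫ s in (0:ℝ)..T, u s * deriv u (s + a) := by
    rw [← integral_comp_add_right_of_periodic (f := fun s => u (s - a) * deriv u s) _ a]
    · simp only [add_sub_cancel_right]
    · intro s
      simp only [hdper s, add_sub_right_comm, hper _]
  have hexact (b : ℝ) :
      ∫ s in (0:ℝ)..T, (deriv u (s + b) * u s + u (s + b) * deriv u s) = 0 := by
    rw [intervalIntegral.integral_deriv_mul_eq_sub (u := fun s => u (s + b))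
      (fun x _ => (hd (x + b)).comp_add_const x b) (fun x _ => hd x)
      (hi (by fun_prop)) (hi hdc), zero_add, add_comm T b, hper b, hper.eq, sub_self]
  have hsplit : ∫ s in (0:ℝ)..T, (u (s + a) - 2 * u s + u (s - a)) * deriv u s
      = (∫ s in (0:ℝ)..T, u (s + a) * deriv u s) - (∫ s in (0:ℝ)..T, 2 * u s * deriv u s)
        + ∫ s in (0:ℝ)..T, u (s - a) * deriv u s := by
    rw [← intervalIntegral.integral_sub (hi (by fun_prop)) (hi (by fun_prop)),
      ← intervalIntegral.integral_add (hi (by fun_prop)) (hi (by fun_prop))]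
    refine intervalIntegral.integral_congr fun s _ => ?_
    ring
  have h0 : ∫ s in (0:ℝ)..T, 2 * u s * deriv u s = 0 := by
    refine Eq.trans ?_ (hexact 0)
    refine intervalIntegral.integral_congr fun s _ => ?_
    simp only [add_zero]
    ring
  rw [hsplit, h0, hback, sub_zero,
    ← intervalIntegral.integral_add (hi (by fun_prop)) (hi (by fun_prop))]
  refine Eq.trans ?_ (hexact a)
  refine intervalIntegral.integral_congr fun s _ => ?_
  ring

open Real in
/-- Equation (wff), tested against a continuous function. -/
theorem WffSolution.integral_mul_eq {n m : ℕ} {Γ K lam : ℝ} {u φ : ℝ → ℝ}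
    (h : WffSolution n m Γ K lam u) (hφ : Continuous φ) :
    (∫ s in (0:ℝ)..(2 * π), deriv (deriv u) s * φ s)
        + lam * Γ * (∫ s in (0:ℝ)..(2 * π), deriv u s * φ s)
        + lam ^ 2 * (∫ s in (0:ℝ)..(2 * π), sin (s + u s) * φ s)
      = lam ^ 2 * (1 / (2 * π)) * (∫ s in (0:ℝ)..(2 * π), sin (s + u s))
          * (∫ s in (0:ℝ)..(2 * π), φ s)
        + lam ^ 2 * K * ∫ s in (0:ℝ)..(2 * π),
            (u (s + 2 * π * m / n) - 2 * u s + u (s - 2 * π * m / n)) * φ s := by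
  obtain ⟨hC, -, -, heq⟩ := h
  have hC1 : ContDiff ℝ 1 (deriv u) := hC.deriv' (n := 1)
  have huc : Continuous u := hC.continuous
  have hdc : Continuous (deriv u) := hC1.continuous
  have hddc : Continuous (deriv (deriv u)) := hC1.continuous_deriv le_rfl
  have hi {f : ℝ → ℝ} (hf : Continuous f) :
      IntervalIntegrable f MeasureTheory.volume 0 (2 * π) := hf.intervalIntegrable _ _
  generalize lam ^ 2 * (1 / (2 * π)) * (∫ s in (0:ℝ)..(2 * π), sin (s + u s)) = S at heq ⊢
  simp only [← intervalIntegral.integral_const_mul]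
  rw [← intervalIntegral.integral_add (hi (by fun_prop)) (hi (by fun_prop)),
    ← intervalIntegral.integral_add (hi (by fun_prop)) (hi (by fun_prop)),
    ← intervalIntegral.integral_add (hi (by fun_prop)) (hi (by fun_prop))]
  refine intervalIntegral.integral_congr fun s _ => ?_
  linear_combination φ s * heq s

open Real in
/-- The energy identity: test equation (wff) against `u`. -/
theorem WffSolution.energy_identity {n m : ℕ} {Γ K lam : ℝ} {u : ℝ → ℝ}
    (h : WffSolution n m Γ K lam u) :
    lam ^ 2 * K * (∫ s in (0:ℝ)..(2 * π), (u (s + 2 * π * m / n) - u s) ^ 2)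
      = (∫ s in (0:ℝ)..(2 * π), deriv u s ^ 2)
        - lam ^ 2 * ∫ s in (0:ℝ)..(2 * π), sin (s + u s) * u s := by
  have htest := h.integral_mul_eq h.1.continuous
  obtain ⟨hC, hper, hmean, -⟩ := h
  have hper : Function.Periodic u (2 * π) := hper
  have hlap := integral_discrete_laplacian_mul_self hC.continuous hper (2 * π * m / n)
  have hC1 : ContDiff ℝ 1 (deriv u) := hC.deriv' (n := 1)
  have huc : Continuous u := hC.continuous
  have hdc : Continuous (deriv u) := hC1.continuous
  have hddc : Continuous (deriv (deriv u)) := hC1.continuous_deriv le_rfl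
  have hu (x : ℝ) : HasDerivAt u (deriv u x) x :=
    (hC.differentiable two_ne_zero x).hasDerivAt
  have hdu (x : ℝ) : HasDerivAt (deriv u) (deriv (deriv u) x) x :=
    (hC1.differentiable one_ne_zero x).hasDerivAt
  have hi {f : ℝ → ℝ} (hf : Continuous f) :
      IntervalIntegrable f MeasureTheory.volume 0 (2 * π) := hf.intervalIntegrable _ _
  have hsecond : ∫ s in (0:ℝ)..(2 * π), deriv (deriv u) s * u s
      = -∫ s in (0:ℝ)..(2 * π), deriv u s ^ 2 := by
    have := intervalIntegral.integral_deriv_mul_eq_sub (a := 0) (b := 2 * π)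
      (fun x _ => hdu x) (fun x _ => hu x) (hi hddc) (hi hdc)
    rw [hper.eq, hper.deriv_periodic.eq, sub_self,
      intervalIntegral.integral_add (hi (by fun_prop)) (hi (by fun_prop))] at this
    simp only [← sq] at this
    linarith
  have hfirst : ∫ s in (0:ℝ)..(2 * π), deriv u s * u s = 0 := by
    have := intervalIntegral.integral_deriv_mul_eq_sub (a := 0) (b := 2 * π)
      (fun x _ => hu x) (fun x _ => hu x) (hi hdc) (hi hdc)
    rw [hper.eq, sub_self,
      intervalIntegral.integral_add (hi (by fun_prop)) (hi (by fun_prop))] at this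
    simp only [mul_comm (u _)] at this
    linarith
  rw [hsecond, hfirst, hmean, hlap] at htest
  linarith

open Real in
/-- The dissipation identity: test equation (wff) against `u'`. -/
theorem WffSolution.dissipation_identity {n m : ℕ} {Γ K lam : ℝ} {u : ℝ → ℝ} (hlam : lam ≠ 0)
    (h : WffSolution n m Γ K lam u) :
    Γ * (∫ s in (0:ℝ)..(2 * π), deriv u s ^ 2)
      = -(lam * ∫ s in (0:ℝ)..(2 * π), sin (s + u s) * deriv u s) := by
  have hC1 : ContDiff ℝ 1 (deriv u) := h.1.deriv' (n := 1)
  have hdc : Continuous (deriv u) := hC1.continuous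
  have hddc : Continuous (deriv (deriv u)) := hC1.continuous_deriv le_rfl
  have htest := h.integral_mul_eq hdc
  obtain ⟨hC, hper, hmean, -⟩ := h
  have hper : Function.Periodic u (2 * π) := hper
  have hlap := integral_discrete_laplacian_mul_deriv (hC.of_le one_le_two) hper (2 * π * m / n)
  have hdu (x : ℝ) : HasDerivAt (deriv u) (deriv (deriv u) x) x :=
    (hC1.differentiable one_ne_zero x).hasDerivAt
  have hi {f : ℝ → ℝ} (hf : Continuous f) :
      IntervalIntegrable f MeasureTheory.volume 0 (2 * π) := hf.intervalIntegrable _ _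
  have hsecond : ∫ s in (0:ℝ)..(2 * π), deriv (deriv u) s * deriv u s = 0 := by
    have := intervalIntegral.integral_deriv_mul_eq_sub (a := 0) (b := 2 * π)
      (fun x _ => hdu x) (fun x _ => hdu x) (hi hddc) (hi hddc)
    rw [hper.deriv_periodic.eq, sub_self,
      intervalIntegral.integral_add (hi (by fun_prop)) (hi (by fun_prop))] at this
    simp only [mul_comm (deriv u _)] at this
    linarith
  have hmean' : ∫ s in (0:ℝ)..(2 * π), deriv u s = 0 := by
    rw [intervalIntegral.integral_deriv_eq_sub (fun x _ => hC.differentiable two_ne_zero x)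
      (hi hdc), hper.eq, sub_self]
  rw [hsecond, hmean', hlap] at htest
  simp only [← sq] at htest
  refine mul_left_cancel₀ hlam ?_
  linarith

open Real in
/-- The damping bounds the `L²` norm of the derivative of solutions of (wff), uniformly in the
coupling `K`. -/
theorem WffSolution.integral_deriv_sq_le {n m : ℕ} {Γ K lam : ℝ} {u : ℝ → ℝ} (hlam : 0 < lam)
    (hΓ : 0 < Γ) (h : WffSolution n m Γ K lam u) :
    ∫ s in (0:ℝ)..(2 * π), deriv u s ^ 2 ≤ 2 * π * lam ^ 2 / Γ ^ 2 := by
  have hdiss := h.dissipation_identity hlam.ne'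
  have huc : Continuous u := h.1.continuous
  have hdc : Continuous (deriv u) := h.1.continuous_deriv one_le_two
  have hyoung := integral_abs_le_add_integral_sq hdc
    (T := 2 * π) (c := lam / (2 * Γ)) (by positivity) (by positivity)
  have hsin : -∫ s in (0:ℝ)..(2 * π), sin (s + u s) * deriv u s
      ≤ ∫ s in (0:ℝ)..(2 * π), |deriv u s| := by
    rw [← intervalIntegral.integral_neg]
    refine intervalIntegral.integral_mono_on (by positivity)
      (Continuous.intervalIntegrable (by fun_prop) _ _)
      (Continuous.intervalIntegrable (by fun_prop) _ _) fun s _ => ?_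
    refine (neg_le_abs _).trans ?_
    rw [abs_mul]
    exact mul_le_of_le_one_left (abs_nonneg _) (abs_sin_le_one _)
  set D := ∫ s in (0:ℝ)..(2 * π), deriv u s ^ 2
  have hbound : Γ * D ≤ lam * (2 * π * (lam / (2 * Γ)) + D / (4 * (lam / (2 * Γ)))) := by
    rw [hdiss, ← mul_neg]
    gcongr
    exact hsin.trans hyoung
  have hcalc : lam * (2 * π * (lam / (2 * Γ)) + D / (4 * (lam / (2 * Γ))))
      = π * lam ^ 2 / Γ + Γ * D / 2 := by
    field_simp
    ring
  rw [hcalc] at hbound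
  refine le_of_mul_le_mul_left ?_ hΓ
  have : Γ * (2 * π * lam ^ 2 / Γ ^ 2) = 2 * (π * lam ^ 2 / Γ) := by
    field_simp
  linarith

open Real in
/-- An a priori bound on the translation increment of solutions of (wff). -/
theorem WffSolution.coupling_mul_integral_sq_le {n m : ℕ} {Γ K lam : ℝ} {u : ℝ → ℝ}
    (hlam : 0 < lam) (hΓ : 0 < Γ) (h : WffSolution n m Γ K lam u) :
    K * (∫ s in (0:ℝ)..(2 * π), (u (s + 2 * π * m / n) - u s) ^ 2)
      ≤ 2 * π / Γ ^ 2 + 2 * π * (2 * π + π * lam ^ 2 / (2 * Γ ^ 2)) := by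
  have henergy := h.energy_identity
  have hD := h.integral_deriv_sq_le hlam hΓ
  obtain ⟨hC, -, hmean, -⟩ := h
  have huc : Continuous u := hC.continuous
  have hC1 : ContDiff ℝ 1 u := hC.of_le one_le_two
  have hyoung := integral_abs_le_add_integral_sq (hC1.continuous_deriv le_rfl)
    (T := 2 * π) (c := 1) (by positivity) one_pos
  have hsin : -∫ s in (0:ℝ)..(2 * π), sin (s + u s) * u s
      ≤ ∫ _ in (0:ℝ)..(2 * π), ∫ t in (0:ℝ)..(2 * π), |deriv u t| := by
    rw [← intervalIntegral.integral_neg]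
    refine intervalIntegral.integral_mono_on (by positivity)
      (Continuous.intervalIntegrable (by fun_prop) _ _) intervalIntegrable_const fun s hs => ?_
    refine (neg_le_abs _).trans ?_
    rw [abs_mul]
    exact (mul_le_of_le_one_left (abs_nonneg _) (abs_sin_le_one _)).trans
      (abs_le_integral_abs_deriv_of_integral_eq_zero (by positivity) hC1 hmean hs)
  rw [intervalIntegral.integral_const, sub_zero, smul_eq_mul] at hsin
  set D := ∫ s in (0:ℝ)..(2 * π), deriv u s ^ 2
  set J := ∫ s in (0:ℝ)..(2 * π), (u (s + 2 * π * m / n) - u s) ^ 2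
  refine le_of_mul_le_mul_left ?_ (pow_pos hlam 2)
  calc lam ^ 2 * (K * J)
      = D + lam ^ 2 * -∫ s in (0:ℝ)..(2 * π), sin (s + u s) * u s := by
        linear_combination henergy
    _ ≤ 2 * π * lam ^ 2 / Γ ^ 2 + lam ^ 2 * (2 * π * (2 * π * 1
          + (2 * π * lam ^ 2 / Γ ^ 2) / (4 * 1))) := by
        gcongr
        refine hsin.trans ?_
        gcongr
        refine hyoung.trans ?_
        gcongr
    _ = _ := by
        field_simp
        ring

open Real in
/-- `sin (π m / n)` vanishes only if `n` divides `m`. -/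
theorem sin_pi_mul_div_ne_zero {n m : ℕ} (hn : n ≠ 0) (hnm : ¬ n ∣ m) :
    sin (2 * π * m / n / 2) ≠ 0 := by
  intro h
  obtain ⟨k, hk⟩ := sin_eq_zero_iff.1 h
  have hn' : (n : ℝ) ≠ 0 := Nat.cast_ne_zero.2 hn
  field_simp at hk
  have hk' : (m : ℤ) = n * k := by
    have : (m : ℝ) = n * k := by linarith
    exact_mod_cast this
  exact hnm (Int.natCast_dvd_natCast.1 ⟨k, hk'⟩)

open Real in
/-- Assume `n` does not divide `m` and fix `Γ̃ > 0`. Given any `λ₀ > 0` and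
`ε > 0`, there exists `K₀ > 0` such that for all `K ≥ K₀` and `Γ ≥ Γ̃`, every
solution `u` of (wff) with parameter `λ₀` satisfies
`|(1/2π)∫₀^{2π} sin(s+u(s)) ds| < ε`. -/
theorem mean_sin_small_of_large_coupling (n m : ℕ) (hn : 1 ≤ n) (hm : 1 ≤ m)
    (hnm : ¬ n ∣ m) (Γtil : ℝ) (hΓtil : 0 < Γtil)
    (lam₀ ε : ℝ) (hlam₀ : 0 < lam₀) (hε : 0 < ε) :
    ∃ K₀ : ℝ, 0 < K₀ ∧ ∀ K Γ : ℝ, K₀ ≤ K → Γtil ≤ Γ →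
      ∀ u : ℝ → ℝ, WffSolution n m Γ K lam₀ u →
        |(1 / (2 * π)) * ∫ s in (0:ℝ)..(2 * π), Real.sin (s + u s)| < ε := by
  set σ := |sin (2 * π * m / n / 2)| with hσ_def
  have hσ : 0 < σ := abs_pos.2 (sin_pi_mul_div_ne_zero (by omega) hnm)
  set B := 2 * π / Γtil ^ 2 + 2 * π * (2 * π + π * lam₀ ^ 2 / (2 * Γtil ^ 2)) with hB
  have hBpos : 0 < B := by positivity
  refine ⟨B / (2 * π * (σ * ε) ^ 2), by positivity, fun K Γ hK hΓ u hu => ?_⟩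
  have hKpos : 0 < K := lt_of_lt_of_le (by positivity) hK
  have hJ := (hu.coupling_mul_integral_sq_le hlam₀ (hΓtil.trans_le hΓ)).trans
    (show _ ≤ B by rw [hB]; gcongr)
  obtain ⟨hC, hper, -, -⟩ := hu
  have huc : Continuous u := hC.continuous
  have hsin := two_mul_abs_sin_mul_abs_integral_sin_le huc hper (2 * π * m / n)
  have hyoung := integral_abs_le_add_integral_sq
    (f := fun s => u (s + 2 * π * m / n) - u s) (by fun_prop)
    (T := 2 * π) (c := σ * ε) (by positivity) (by positivity)
  rw [← hσ_def] at hsin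
  set J := ∫ s in (0:ℝ)..(2 * π), (u (s + 2 * π * m / n) - u s) ^ 2
  have hJle : J ≤ 2 * π * (σ * ε) ^ 2 := by
    rw [div_le_iff₀ (by positivity)] at hK
    refine le_of_mul_le_mul_left ?_ hKpos
    linarith
  have hJdiv : J / (4 * (σ * ε)) ≤ π * (σ * ε) / 2 := by
    rw [div_le_iff₀ (by positivity)]
    linarith
  rw [abs_mul, abs_of_pos (by positivity : 0 < 1 / (2 * π)), one_div, inv_mul_lt_iff₀ (by positivity)]
  refine lt_of_mul_lt_mul_left ?_ (by positivity : 0 ≤ 2 * σ)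
  have : 0 < π * (σ * ε) := by positivity
  linarith
end

section
/- If 0 < λ < Γ, then equation (wff) with parameter λ has at most one solution: if u₁ and u₂ are both twice continuously differentiable 2π-periodic functions with zero mean on [0, 2π] satisfying (wff) with parameter λ, then u₁ = u₂. -/
open Real MeasureTheory

/-- **Wirtinger's inequality** for `2π`-periodic functions of zero mean. -/
lemma integral_sq_le_integral_deriv_sq {f f' : ℝ → ℝ} (hf : ∀ x, HasDerivAt f (f' x) x)
    (hf' : Continuous f') (hper : f (2 * π) = f 0)
    (hmean : ∫ x in (0 : ℝ)..(2 * π), f x = 0) :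
    ∫ x in (0 : ℝ)..(2 * π), f x ^ 2 ≤ ∫ x in (0 : ℝ)..(2 * π), f' x ^ 2 := by
  have hab : (0 : ℝ) < 2 * π := two_pi_pos
  have hfc : Continuous f := continuous_iff_continuousAt.2 fun x => (hf x).continuousAt
  have memLp_two {g : ℝ → ℝ} (hg : Continuous g) :
      MemLp (fun x => (g x : ℂ)) 2 (volume.restrict (Set.Ioc 0 (2 * π))) := by
    have hgc : Continuous fun x => (g x : ℂ) := Complex.continuous_ofReal.comp hg
    obtain ⟨C, hC⟩ := isCompact_Icc.exists_bound_of_continuousOn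
      (hgc.continuousOn (s := Set.Icc 0 (2 * π)))
    refine MemLp.of_bound hgc.aestronglyMeasurable C ?_
    filter_upwards [ae_restrict_mem measurableSet_Ioc] with x hx
    exact hC x (Set.Ioc_subset_Icc_self hx)
  have parseval := hasSum_sq_fourierCoeffOn hab (memLp_two hfc)
  have parseval' := hasSum_sq_fourierCoeffOn hab (memLp_two hf')
  have coeff_le (i : ℤ) : ‖fourierCoeffOn hab (fun x => (f x : ℂ)) i‖ ^ 2 ≤
      ‖fourierCoeffOn hab (fun x => (f' x : ℂ)) i‖ ^ 2 := by
    rcases eq_or_ne i 0 with rfl | hi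
    · have : fourierCoeffOn hab (fun x => (f x : ℂ)) 0 = 0 := by
        rw [fourierCoeffOn_eq_integral]
        simp [intervalIntegral.integral_ofReal, hmean]
      rw [this]
      simp
    · rw [fourierCoeffOn_of_hasDerivAt hab hi (fun x _ => (hf x).ofReal_comp)
        ((Complex.continuous_ofReal.comp hf').intervalIntegrable 0 (2 * π))]
      gcongr
      have hi1 : (1 : ℝ) ≤ |(i : ℝ)| := by exact_mod_cast Int.one_le_abs hi
      simp only [hper, sub_self, mul_zero, zero_sub, norm_mul, norm_neg, norm_div, norm_one,
        Complex.ofReal_zero, sub_zero, Complex.ofReal_mul, Complex.ofReal_ofNat,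
        Complex.norm_ofNat, Complex.norm_I, Complex.norm_real, Real.norm_eq_abs,
        abs_of_pos pi_pos, mul_one, Complex.norm_intCast]
      rw [← mul_assoc]
      refine mul_le_of_le_one_left (norm_nonneg _) ?_
      rw [div_mul_eq_mul_div, one_mul, div_le_one (by positivity)]
      nlinarith [pi_pos]
  have key := hasSum_le coeff_le parseval parseval'
  simp only [sub_zero, smul_eq_mul, Complex.norm_real, Real.norm_eq_abs, sq_abs] at key
  exact le_of_mul_le_mul_left key (by positivity)

/-- A `2π`-periodic function of zero mean whose derivative satisfies the differential inequality
obtained from an energy estimate with a small source term vanishes. -/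
lemma eq_zero_of_integral_deriv_sq_le {f f' : ℝ → ℝ} {c d : ℝ}
    (hf : ∀ x, HasDerivAt f (f' x) x) (hf' : Continuous f') (hper : f.Periodic (2 * π))
    (hmean : ∫ x in (0 : ℝ)..(2 * π), f x = 0) (hd : 0 ≤ d) (hdc : d < c)
    (henergy : c * ∫ x in (0 : ℝ)..(2 * π), f' x ^ 2 ≤
      d / 2 * ((∫ x in (0 : ℝ)..(2 * π), f x ^ 2) + ∫ x in (0 : ℝ)..(2 * π), f' x ^ 2)) :
    f = 0 := by
  have hfc : Continuous f := continuous_iff_continuousAt.2 fun x => (hf x).continuousAt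
  have hW := integral_sq_le_integral_deriv_sq hf hf' (by simpa using hper 0) hmean
  have hle : ∫ x in (0 : ℝ)..(2 * π), f x ^ 2 ≤ 0 := by nlinarith
  have hzero : ∀ x ∈ Set.Icc 0 (2 * π), f x = 0 := by
    by_contra! h
    obtain ⟨x, hx, hne⟩ := h
    exact hle.not_gt <| intervalIntegral.integral_pos two_pi_pos (hfc.pow 2).continuousOn
      (fun _ _ => sq_nonneg _) ⟨x, hx, by positivity⟩
  funext x
  obtain ⟨y, hy, hxy⟩ := hper.exists_mem_Ico₀ two_pi_pos x
  exact hxy.trans (hzero y (Set.Ico_subset_Icc_self hy))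

lemma periodic_deriv {f f' : ℝ → ℝ} {T : ℝ} (hf : ∀ x, HasDerivAt f (f' x) x)
    (hper : f.Periodic T) : f'.Periodic T := fun x => by
  have h := (hf (x + T)).comp_add_const x T
  rw [hper.funext] at h
  exact h.unique (hf x)

/-- If `f` solves a damped equation with a periodic conservative nonlocal coupling and a source
term `g` dominated by `f`, then the dissipation is controlled by the source. -/
lemma damped_energy_le {f f' f'' g : ℝ → ℝ} {a c d C k : ℝ}
    (hf : ∀ x, HasDerivAt f (f' x) x) (hf' : ∀ x, HasDerivAt f' (f'' x) x)
    (hf'' : Continuous f'') (hper : f.Periodic (2 * π)) (hd : 0 ≤ d)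
    (hg : ∀ x, |g x| ≤ |f x|)
    (heq : ∀ x, f'' x + c * f' x + d * g x = C + k * (f (x + a) - 2 * f x + f (x - a))) :
    c * ∫ x in (0 : ℝ)..(2 * π), f' x ^ 2 ≤
      d / 2 * ((∫ x in (0 : ℝ)..(2 * π), f x ^ 2) + ∫ x in (0 : ℝ)..(2 * π), f' x ^ 2) := by
  have hfc : Continuous f := continuous_iff_continuousAt.2 fun x => (hf x).continuousAt
  have hfc' : Continuous f' := continuous_iff_continuousAt.2 fun x => (hf' x).continuousAt
  have hper' := periodic_deriv hf hper
  set G : ℝ → ℝ := fun x => C * f x + k * (f x * f (x - a) - f x ^ 2) - f' x ^ 2 / 2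
  set G' : ℝ → ℝ := fun x => C * f' x + k * (f' x * f (x - a) + f x * f' (x - a) -
    2 * f x * f' x) - f' x * f'' x
  set H : ℝ → ℝ := fun x => f (x + a) * f' x
  have hGderiv (x : ℝ) : HasDerivAt G (G' x) x := by
    have h := (((hf x).const_mul C).add
      ((((hf x).mul ((hf (x - a)).comp_sub_const x a)).sub ((hf x).pow 2)).const_mul k)).sub
      (((hf' x).pow 2).div_const 2)
    refine h.congr_deriv ?_
    simp only [G', pow_one, Nat.cast_ofNat, Nat.add_one_sub_one]
    ring
  have hG'c : Continuous G' := by fun_prop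
  have hHc : Continuous H := by fun_prop
  have hG'int : ∫ x in (0 : ℝ)..(2 * π), G' x = 0 := by
    rw [intervalIntegral.integral_eq_sub_of_hasDerivAt (fun x _ => hGderiv x)
      (hG'c.intervalIntegrable _ _)]
    have h1 : f (2 * π) = f 0 := by simpa using hper 0
    have h2 : f' (2 * π) = f' 0 := by simpa using hper' 0
    have h3 : f (2 * π - a) = f (0 - a) := by
      rw [← hper (0 - a)]
      ring_nf
    simp [G, h1, h2, h3]
  have hHper : H.Periodic (2 * π) := fun x => by
    simp only [H, hper' x]
    rw [add_right_comm, hper]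
  have hHint : ∫ x in (0 : ℝ)..(2 * π), H (x - a) = ∫ x in (0 : ℝ)..(2 * π), H x := by
    rw [intervalIntegral.integral_comp_sub_right]
    have := hHper.intervalIntegral_add_eq (0 - a) 0
    rwa [show 0 - a + 2 * π = 2 * π - a by ring, zero_add] at this
  have hpt (x : ℝ) : c * f' x ^ 2 ≤
      d / 2 * (f x ^ 2 + f' x ^ 2) + (G' x + k * (H x - H (x - a))) := by
    have hsource : -(g x * f' x) ≤ (f x ^ 2 + f' x ^ 2) / 2 := by
      have h1 : |g x * f' x| ≤ |f x| * |f' x| := by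
        rw [abs_mul]
        exact mul_le_mul_of_nonneg_right (hg x) (abs_nonneg _)
      nlinarith [neg_abs_le (g x * f' x), sq_nonneg (|f x| - |f' x|), sq_abs (f x), sq_abs (f' x)]
    have hsource' := mul_le_mul_of_nonneg_left hsource hd
    have heq' := congrArg (· * f' x) (heq x)
    simp only [G', H, sub_add_cancel] at heq' ⊢
    linarith
  have hmono := intervalIntegral.integral_mono (μ := volume) two_pi_pos.le
    ((by fun_prop : Continuous fun x => c * f' x ^ 2).intervalIntegrable _ _)
    ((by fun_prop : Continuous fun x =>
      d / 2 * (f x ^ 2 + f' x ^ 2) + (G' x + k * (H x - H (x - a)))).intervalIntegrable _ _) hpt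
  have ii {φ : ℝ → ℝ} (hφ : Continuous φ) : IntervalIntegrable φ volume 0 (2 * π) :=
    hφ.intervalIntegrable _ _
  rw [intervalIntegral.integral_add (ii (by fun_prop)) (ii (by fun_prop)),
    intervalIntegral.integral_add (ii hG'c) (ii (by fun_prop)),
    intervalIntegral.integral_const_mul, intervalIntegral.integral_const_mul,
    intervalIntegral.integral_const_mul,
    intervalIntegral.integral_add (ii (by fun_prop)) (ii (by fun_prop)),
    intervalIntegral.integral_sub (ii hHc) (ii (by fun_prop)), hG'int, hHint] at hmono
  linarith

/-- If `0 < λ < Γ` then equation (wff) with parameter `λ` has at most one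
solution. -/
theorem wffSolution_unique (n m : ℕ) (hn : 1 ≤ n) (hm : 1 ≤ m)
    (Γ K lam : ℝ) (hΓ : 0 < Γ) (hK : 0 < K)
    (hlam : 0 < lam) (hlam' : lam < Γ)
    (u₁ u₂ : ℝ → ℝ) (h₁ : WffSolution n m Γ K lam u₁)
    (h₂ : WffSolution n m Γ K lam u₂) : u₁ = u₂ := by
  obtain ⟨hc₁, hper₁, hmean₁, heq₁⟩ := h₁
  obtain ⟨hc₂, hper₂, hmean₂, heq₂⟩ := h₂
  have hd {u : ℝ → ℝ} (hu : ContDiff ℝ 2 u) (x : ℝ) : HasDerivAt u (deriv u x) x :=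
    (hu.differentiable (by norm_num) x).hasDerivAt
  have hderiv {u : ℝ → ℝ} (hu : ContDiff ℝ 2 u) : ContDiff ℝ 1 (deriv u) :=
    ((contDiff_succ_iff_deriv (n := 1)).1 (by simpa [one_add_one_eq_two] using hu)).2.2
  have hd' {u : ℝ → ℝ} (hu : ContDiff ℝ 2 u) (x : ℝ) :
      HasDerivAt (deriv u) (deriv (deriv u) x) x :=
    ((hderiv hu).differentiable (by norm_num) x).hasDerivAt
  have hd'' {u : ℝ → ℝ} (hu : ContDiff ℝ 2 u) : Continuous (deriv (deriv u)) :=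
    (hderiv hu).continuous_deriv le_rfl
  have hf (x : ℝ) : HasDerivAt (fun x => u₁ x - u₂ x) (deriv u₁ x - deriv u₂ x) x :=
    (hd hc₁ x).sub (hd hc₂ x)
  have hper : Function.Periodic (fun x => u₁ x - u₂ x) (2 * π) := fun x => by
    simp only [hper₁, hper₂]
  have hmean : ∫ x in (0 : ℝ)..(2 * π), (u₁ x - u₂ x) = 0 := by
    rw [intervalIntegral.integral_sub (hc₁.continuous.intervalIntegrable _ _)
      (hc₂.continuous.intervalIntegrable _ _), hmean₁, hmean₂, sub_zero]
  have henergy := damped_energy_le (a := 2 * π * m / n) (c := lam * Γ) (d := lam ^ 2)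
    (k := lam ^ 2 * K) (g := fun x => sin (x + u₁ x) - sin (x + u₂ x))
    (C := lam ^ 2 * (1 / (2 * π)) * (∫ s in (0 : ℝ)..(2 * π), sin (s + u₁ s)) -
      lam ^ 2 * (1 / (2 * π)) * (∫ s in (0 : ℝ)..(2 * π), sin (s + u₂ s)))
    hf (fun x => (hd' hc₁ x).sub (hd' hc₂ x)) ((hd'' hc₁).sub (hd'' hc₂)) hper (sq_nonneg lam)
    (fun x => by simpa using abs_sin_sub_sin_le (x + u₁ x) (x + u₂ x))
    (fun x => by linarith [heq₁ x, heq₂ x])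
  have hzero := eq_zero_of_integral_deriv_sq_le hf
    ((hderiv hc₁).continuous.sub (hderiv hc₂).continuous) hper hmean (sq_nonneg lam)
    (by nlinarith) henergy
  funext x
  exact sub_eq_zero.1 (congrFun hzero x)
end
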